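/- Let N = 1, T > 0, α > 0, and let f : ℝ × (0,T) → ℝ be non-negative, bounded and measurable. Let −∞ < s_{0−} < s_{0+} < ∞. Then there exists no triple (u, s_−, s_+) with s_± : [0,T) → ℝ continuous on [0,T), continuously differentiable on (0,T), s_−(t) < s_+(t), s_±(0) = s_{0±}, and u a non-negative bounded classical solution of ∂_t u − ∂_x² u = f on the moving domain {(x,t) : s_−(t) < x < s_+(t), 0 < t < T}, with u and ∂_x u continuous up to both free boundaries, satisfying u(s_±(t),t) = 0, ∂_x u(s_−(t),t) = α, ∂_x u(s_+(t),t) = −α for 0 < t < T, continuous up to t = 0 with u(·,0) ≡ 0 on [s_{0−}, s_{0+}]. -/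

import Mathlib

set_option autoImplicit false

open Set Filter

open Topology in
theorem npaux_second {g g' : ℝ → ℝ} {x L : ℝ} (hmax : IsLocalMax g x)
    (hg : ∀ᶠ y in 𝓝 x, HasDerivAt g (g' y) y) (hL : HasDerivAt g' L x) : L ≤ 0 := by
  by_contra hpos
  push Not at hpos
  have e1 : deriv g =ᶠ[𝓝 x] g' := hg.mono fun y hy => hy.deriv
  have e2 : deriv (deriv g) x = L := by rw [e1.deriv_eq, hL.deriv]
  have hmin : IsLocalMin g x := by
    apply isLocalMin_of_deriv_deriv_pos
    · rw [e2]; exact hpos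
    · exact hmax.deriv_eq_zero
    · exact hg.self_of_nhds.continuousAt
  have e3 : g =ᶠ[𝓝 x] fun _ => g x := by
    filter_upwards [hmax, hmin] with y h1 h2
    exact le_antisymm h1 h2
  have e4 : deriv (deriv g) x = 0 := by
    rw [e3.deriv.deriv_eq]; simp
  linarith

open Topology in
theorem npaux_time {g : ℝ → ℝ} {t D : ℝ} (hg : HasDerivAt g D t)
    (hmax : ∀ᶠ y in 𝓝[<] t, g y ≤ g t) : 0 ≤ D := by
  have h1 : HasDerivWithinAt g D (Iio t) t := hg.hasDerivWithinAt
  rw [hasDerivWithinAt_iff_tendsto_slope' (by simp)] at h1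
  refine ge_of_tendsto h1 ?_
  filter_upwards [hmax, self_mem_nhdsWithin] with y hy hyt
  have hyt' : y < t := hyt
  rw [slope_def_field]
  exact div_nonneg_of_nonpos (by linarith) (by linarith)

open Topology in
theorem npaux_cmp (t1 : ℝ) (ht1 : 0 ≤ t1) (a r : ℝ → ℝ)
    (ha : ContinuousOn a (Icc 0 t1)) (hr : ContinuousOn r (Icc 0 t1))
    (ha' : ∀ t ∈ Ioc 0 t1, ContinuousAt a t) (hr' : ∀ t ∈ Ioc 0 t1, ContinuousAt r t)
    (v vx vxx vt : ℝ → ℝ → ℝ)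
    (hv : ContinuousOn (fun p : ℝ × ℝ => v p.1 p.2)
      {p : ℝ × ℝ | p.2 ∈ Icc 0 t1 ∧ a p.2 ≤ p.1 ∧ p.1 ≤ r p.2})
    (h0 : ∀ x, a 0 ≤ x → x ≤ r 0 → v x 0 ≤ 0)
    (hl : ∀ t ∈ Ioc 0 t1, a t ≤ r t → v (a t) t ≤ 0)
    (hrr : ∀ t ∈ Ioc 0 t1, a t ≤ r t → v (r t) t ≤ 0)
    (hd : ∀ t ∈ Ioc 0 t1, ∀ x, a t < x → x < r t →
      HasDerivAt (fun ξ => v ξ t) (vx x t) x ∧ HasDerivAt (fun ξ => vx ξ t) (vxx x t) x ∧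
      HasDerivAt (fun τ => v x τ) (vt x t) t ∧ vt x t - vxx x t < 0) :
    ∀ t ∈ Icc 0 t1, ∀ x, a t ≤ x → x ≤ r t → v x t ≤ 0 := by
  set R := {p : ℝ × ℝ | p.2 ∈ Icc 0 t1 ∧ a p.2 ≤ p.1 ∧ p.1 ≤ r p.2} with hR
  have hcomp : IsCompact R := by
    obtain ⟨A, hA⟩ := (isCompact_Icc.image_of_continuousOn ha).bddBelow
    obtain ⟨B, hB⟩ := (isCompact_Icc.image_of_continuousOn hr).bddAbove
    have hAc : Continuous (IccExtend ht1 ((Icc 0 t1).domRestrict a)) :=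
      (continuousOn_iff_continuous_domRestrict.1 ha).Icc_extend'
    have hBc : Continuous (IccExtend ht1 ((Icc 0 t1).domRestrict r)) :=
      (continuousOn_iff_continuous_domRestrict.1 hr).Icc_extend'
    have hEq : R = {p : ℝ × ℝ | p.2 ∈ Icc 0 t1} ∩
        ({p | IccExtend ht1 ((Icc 0 t1).domRestrict a) p.2 ≤ p.1} ∩
         {p | p.1 ≤ IccExtend ht1 ((Icc 0 t1).domRestrict r) p.2}) := by
      ext p
      simp only [hR, mem_ofPred_eq, mem_inter_iff]
      refine and_congr_right fun hp => ?_
      rw [IccExtend_of_mem ht1 _ hp, IccExtend_of_mem ht1 _ hp]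
      exact Iff.rfl
    have hcl : IsClosed R := by
      rw [hEq]
      refine (isClosed_Icc.preimage continuous_snd).inter ?_
      exact (isClosed_le (hAc.comp continuous_snd) continuous_fst).inter
        (isClosed_le continuous_fst (hBc.comp continuous_snd))
    refine (isCompact_Icc (a := A) (b := B)).prod (isCompact_Icc (a := (0:ℝ)) (b := t1))
      |>.of_isClosed_subset hcl ?_
    rintro p ⟨h1, h2, h3⟩
    exact ⟨⟨(hA (mem_image_of_mem _ h1)).trans h2, h3.trans (hB (mem_image_of_mem _ h1))⟩, h1⟩
  intro t ht x hx1 hx2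
  obtain ⟨⟨y, s⟩, hq, hmax⟩ := hcomp.exists_isMaxOn ⟨(x, t), ht, hx1, hx2⟩ hv
  have hle : ∀ x t, (x, t) ∈ R → v x t ≤ v y s := fun x t h => hmax h
  refine (hle x t ⟨ht, hx1, hx2⟩).trans ?_
  obtain ⟨hs, hy1, hy2⟩ := hq
  simp only at hs hy1 hy2
  rcases hs.1.eq_or_lt with h | hspos
  · subst h; exact h0 y hy1 hy2
  have hs' : s ∈ Ioc 0 t1 := ⟨hspos, hs.2⟩
  rcases hy1.eq_or_lt with h | hya
  · rw [← h]; exact hl s hs' (hy1.trans hy2)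
  rcases hy2.eq_or_lt with h | hyr
  · rw [h]; exact hrr s hs' (hy1.trans hy2)
  exfalso
  obtain ⟨d1, d2, d3, d4⟩ := hd s hs' y hya hyr
  have hnx : ∀ᶠ z in 𝓝 y, a s < z ∧ z < r s := Ioo_mem_nhds hya hyr
  have k1 : vxx y s ≤ 0 := by
    refine npaux_second (g := fun ξ => v ξ s) (g' := fun ξ => vx ξ s) ?_ ?_ d2
    · filter_upwards [hnx] with z hz
      exact hle z s ⟨hs, hz.1.le, hz.2.le⟩
    · filter_upwards [hnx] with z hz
      exact (hd s hs' z hz.1 hz.2).1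
  have k2 : 0 ≤ vt y s := by
    refine npaux_time d3 ?_
    have e1 : ∀ᶠ τ in 𝓝[<] s, a τ < y :=
      ((ha' s hs').eventually (Iio_mem_nhds hya)).filter_mono nhdsWithin_le_nhds
    have e2 : ∀ᶠ τ in 𝓝[<] s, y < r τ :=
      ((hr' s hs').eventually (Ioi_mem_nhds hyr)).filter_mono nhdsWithin_le_nhds
    filter_upwards [e1, e2, Ioo_mem_nhdsLT hspos] with τ h1 h2 h3
    exact hle y τ ⟨⟨h3.1.le, h3.2.le.trans hs.2⟩, h1.le, h2.le⟩
  linarith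

/-- **No formation of a new phase, one-dimensional case, bounded initial domain.**
For `N = 1`, `T > 0`, `α > 0`, a non-negative bounded measurable heat source `f` and an
initial interval `(s₀m, s₀p)` with `s₀m < s₀p`, there is no triple `(u, sm, sp)` such that
`sm, sp` are continuous on `[0,T)`, continuously differentiable on `(0,T)` with
`sm t < sp t` and `sm 0 = s₀m`, `sp 0 = s₀p`, and `u` is a non-negative bounded classical
solution of `∂ₜu - ∂ₓ²u = f` on the moving domain `{sm t < x < sp t, 0 < t < T}`,
continuous together with `∂ₓu` up to both free boundaries, with `u(sm t, t) = u(sp t, t) = 0`,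
`∂ₓu(sm t, t) = α`, `∂ₓu(sp t, t) = -α`, continuous up to `t = 0` with `u(·,0) ≡ 0`. -/
theorem no_new_phase_one_dimensional_bounded_domain
    (T α : ℝ) (hT : 0 < T) (hα : 0 < α)
    (f : ℝ → ℝ → ℝ)
    (hf_nonneg : ∀ x : ℝ, ∀ t ∈ Ioo 0 T, 0 ≤ f x t)
    (hf_bdd : ∃ M : ℝ, ∀ x : ℝ, ∀ t ∈ Ioo 0 T, f x t ≤ M)
    (hf_meas : Measurable fun p : ℝ × ℝ => f p.1 p.2)
    (s₀m s₀p : ℝ) (hs₀ : s₀m < s₀p) :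
    ¬ ∃ (u : ℝ → ℝ → ℝ) (sm sp : ℝ → ℝ) (ux uxx : ℝ → ℝ → ℝ),
      -- regularity of the two free boundaries
      ContinuousOn sm (Ico 0 T) ∧ ContinuousOn sp (Ico 0 T) ∧
      (∀ t ∈ Ioo 0 T, DifferentiableAt ℝ sm t ∧ DifferentiableAt ℝ sp t) ∧
      ContinuousOn (deriv sm) (Ioo 0 T) ∧ ContinuousOn (deriv sp) (Ioo 0 T) ∧
      (∀ t ∈ Ico 0 T, sm t < sp t) ∧
      sm 0 = s₀m ∧ sp 0 = s₀p ∧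
      -- u is a classical solution of ∂ₜ u - ∂ₓ² u = f in the moving domain
      (∀ t ∈ Ioo 0 T, ∀ x : ℝ, sm t < x → x < sp t →
        HasDerivAt (fun ξ => u ξ t) (ux x t) x ∧
        HasDerivAt (fun ξ => ux ξ t) (uxx x t) x ∧
        HasDerivAt (fun τ => u x τ) (uxx x t + f x t) t) ∧
      -- u is non-negative on the closed moving domain
      (∀ t ∈ Ico 0 T, ∀ x : ℝ, sm t ≤ x → x ≤ sp t → 0 ≤ u x t) ∧
      -- u is bounded
      (∃ M : ℝ, ∀ t ∈ Ico 0 T, ∀ x : ℝ, sm t ≤ x → x ≤ sp t → u x t ≤ M) ∧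
      -- u is continuous up to the free boundaries and up to t = 0
      ContinuousOn (fun p : ℝ × ℝ => u p.1 p.2)
        {p : ℝ × ℝ | p.2 ∈ Ico 0 T ∧ sm p.2 ≤ p.1 ∧ p.1 ≤ sp p.2} ∧
      -- ∂ₓ u is continuous up to the free boundaries
      ContinuousOn (fun p : ℝ × ℝ => ux p.1 p.2)
        {p : ℝ × ℝ | p.2 ∈ Ioo 0 T ∧ sm p.2 ≤ p.1 ∧ p.1 ≤ sp p.2} ∧
      -- Dirichlet boundary conditions
      (∀ t ∈ Ioo 0 T, u (sm t) t = 0 ∧ u (sp t) t = 0) ∧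
      -- exterior normal derivative condition ∂u/∂ν = -α on both boundary points
      (∀ t ∈ Ioo 0 T, ux (sm t) t = α ∧ ux (sp t) t = -α) ∧
      -- zero initial value on [s₀m, s₀p]
      (∀ x ∈ Icc s₀m s₀p, u x 0 = 0) := by
  rintro ⟨u, sm, sp, ux, uxx, hsm, hsp, hsd, -, -, hlt, hsm0, hsp0, hpde, hnn, -, huc, huxc,
    hdir, hneu, hini⟩
  obtain ⟨M, hM⟩ := hf_bdd
  obtain ⟨K, hKpos, hK⟩ : ∃ K : ℝ, 0 < K ∧ ∀ x : ℝ, ∀ t ∈ Ioo 0 T, f x t < K :=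
    ⟨|M| + 1, by positivity, fun x t ht => by
      have := hM x t ht
      have := le_abs_self M
      linarith⟩
  obtain ⟨β, hβ, hβα⟩ : ∃ β : ℝ, 0 < β ∧ β < α := ⟨α / 2, by linarith, by linarith⟩
  -- choice of a small time
  obtain ⟨t1, ht1, ht1T, hsmall⟩ : ∃ t1 : ℝ, 0 < t1 ∧ t1 < T ∧
      2 * K * ((|sm t1 - sm 0| + t1) * β + K * t1) < β ^ 2 := by
    have hc : ContinuousWithinAt sm (Ioi 0) 0 := by
      refine (hsm 0 ⟨le_rfl, hT⟩).mono_of_mem_nhdsWithin ?_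
      exact mem_of_superset (Ioo_mem_nhdsGT hT) Ioo_subset_Ico_self
    have hc2 : ContinuousWithinAt
        (fun t => 2 * K * ((|sm t - sm 0| + t) * β + K * t)) (Ioi 0) 0 := by
      have : ContinuousWithinAt (fun t : ℝ => t) (Ioi 0) 0 := continuousWithinAt_id
      exact (((((hc.sub continuousWithinAt_const).abs).add this).mul
        continuousWithinAt_const).add (continuousWithinAt_const.mul this)).const_smul (2 * K)
    have hev := hc2.tendsto.eventually (Iio_mem_nhds
      (show 2 * K * ((|sm 0 - sm 0| + 0) * β + K * 0) < β ^ 2 by simp; positivity))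
    obtain ⟨t1, h1, h2⟩ := (hev.and (Ioo_mem_nhdsGT hT)).exists
    exact ⟨t1, h2.1, h2.2, h1⟩
  have hsubI : Icc 0 t1 ⊆ Ico 0 T := fun t ht => ⟨ht.1, ht.2.trans_lt ht1T⟩
  have hsubO : ∀ t ∈ Ioc 0 t1, t ∈ Ioo 0 T := fun t ht => ⟨ht.1, ht.2.trans_lt ht1T⟩
  have hsmI := hsm.mono hsubI
  have hspI := hsp.mono hsubI
  -- Step 1
  have step1 : ∀ t ∈ Icc 0 t1, ∀ x, sm t ≤ x → x ≤ sp t → u x t ≤ K * t := by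
    intro t ht x h1 h2
    have := npaux_cmp t1 ht1.le sm sp hsmI hspI
      (fun t ht => (hsd t (hsubO t ht)).1.continuousAt)
      (fun t ht => (hsd t (hsubO t ht)).2.continuousAt)
      (fun x t => u x t - K * t) ux uxx (fun x t => uxx x t + f x t - K * 1)
      ?_ ?_ ?_ ?_ ?_ t ht x h1 h2
    · linarith
    · refine (huc.mono ?_).sub (by fun_prop)
      rintro p ⟨h1, h2⟩
      exact ⟨hsubI h1, h2⟩
    · intro x h1 h2
      have := hini x ⟨by linarith, by linarith⟩
      simp [this]
    · intro t ht _
      have := (hdir t (hsubO t ht)).1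
      have := mul_nonneg hKpos.le ht.1.le
      linarith
    · intro t ht _
      have := (hdir t (hsubO t ht)).2
      have := mul_nonneg hKpos.le ht.1.le
      linarith
    · intro t ht x h1 h2
      obtain ⟨d1, d2, d3⟩ := hpde t (hsubO t ht) x h1 h2
      refine ⟨d1.sub_const _, d2, d3.sub ((hasDerivAt_id t).const_mul K), ?_⟩
      have := hK x t (hsubO t ht)
      linarith
  -- the moving barrier
  set c := (|sm t1 - sm 0| + t1) / t1 with hc
  have hcpos : 0 < c := by positivity
  have hct : c * t1 = |sm t1 - sm 0| + t1 := by rw [hc]; field_simp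
  obtain ⟨t0, ht0, hmin⟩ := (isCompact_Icc (a := (0:ℝ)) (b := t1)).exists_isMinOn
    ⟨0, le_rfl, ht1.le⟩ (f := fun t => sm t - c * t) (hsmI.sub (by fun_prop))
  have hmin' : ∀ t ∈ Icc 0 t1, sm t0 - c * t0 ≤ sm t - c * t := fun t ht => hmin ht
  have ht0pos : 0 < t0 := by
    rcases ht0.1.eq_or_lt with h | h
    · exfalso
      have h1 := hmin' t1 ⟨ht1.le, le_rfl⟩
      rw [← h] at h1
      have := le_abs_self (sm t1 - sm 0)
      linarith
    · exact h
  obtain ⟨b, hb⟩ : ∃ b, b = sm t0 - c * t0 := ⟨_, rfl⟩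
  rw [← hb] at hmin'
  obtain ⟨L, hL⟩ : ∃ L, L = c * β + K := ⟨_, rfl⟩
  have hLpos : 0 < L := by rw [hL]; positivity
  obtain ⟨l, hl⟩ : ∃ l, l = β / L := ⟨_, rfl⟩
  have hlpos : 0 < l := by rw [hl]; positivity
  have hLl : L * l = β := by rw [hl]; field_simp
  have hφ : ∀ ξ, 0 ≤ ξ → ξ ≤ l → 0 ≤ β * ξ - L * ξ ^ 2 / 2 := by
    intro ξ h1 h2
    rw [← hLl]
    have : 0 ≤ L * ξ * (l - ξ / 2) :=
      mul_nonneg (mul_nonneg hLpos.le h1) (by linarith)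
    nlinarith
  have hφl : K * t1 ≤ β * l - L * l ^ 2 / 2 := by
    have e : β * l - L * l ^ 2 / 2 = β ^ 2 / (2 * L) := by
      rw [hl]; field_simp; ring
    rw [e, le_div_iff₀ (by positivity), hL]
    rw [← hct] at hsmall
    nlinarith
  have step2 : ∀ t ∈ Icc 0 t1, ∀ x, sm t ≤ x → x ≤ min (sp t) (b + c * t + l) →
      u x t ≤ β * (x - b - c * t) - L * (x - b - c * t) ^ 2 / 2 := by
    intro t ht x h1 h2
    have := npaux_cmp t1 ht1.le sm (fun t => min (sp t) (b + c * t + l)) hsmI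
      (ContinuousOn.inf hspI (by fun_prop))
      (fun t ht => (hsd t (hsubO t ht)).1.continuousAt)
      (fun t ht => (hsd t (hsubO t ht)).2.continuousAt.min
        (show ContinuousAt (fun t => b + c * t + l) t by fun_prop))
      (fun x t => u x t - (β * (x - b - c * t) - L * (x - b - c * t) ^ 2 / 2))
      (fun x t => ux x t - (β - L * (x - b - c * t)))
      (fun x t => uxx x t - (- L))
      (fun x t => uxx x t + f x t - (- c * (β - L * (x - b - c * t))))
      ?_ ?_ ?_ ?_ ?_ t ht x h1 h2
    · linarith
    · refine (huc.mono ?_).sub (by fun_prop)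
      rintro p ⟨h1, h2, h3⟩
      exact ⟨hsubI h1, h2, h3.trans (min_le_left _ _)⟩
    · intro x h1 h2
      have h3 := le_min_iff.1 h2
      have := hini x ⟨by linarith, by linarith⟩
      have h4 := hmin' 0 ⟨le_rfl, ht1.le⟩
      have := hφ (x - b - c * 0) (by linarith) (by linarith)
      linarith
    · intro t ht h2
      have h3 := le_min_iff.1 h2
      have := (hdir t (hsubO t ht)).1
      have h4 := hmin' t ⟨ht.1.le, ht.2⟩
      have := hφ (sm t - b - c * t) (by linarith) (by linarith)
      linarith
    · intro t ht h2
      have h3 := le_min_iff.1 h2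
      have h4 := hmin' t ⟨ht.1.le, ht.2⟩
      rcases le_total (sp t) (b + c * t + l) with h | h
      · rw [min_eq_left h]
        have := (hdir t (hsubO t ht)).2
        have := hlt t (hsubI ⟨ht.1.le, ht.2⟩)
        have := hφ (sp t - b - c * t) (by linarith) (by linarith)
        linarith
      · rw [min_eq_right h]
        have h5 := step1 t ⟨ht.1.le, ht.2⟩ (b + c * t + l) h3.2 h
        have h6 : K * t ≤ K * t1 := mul_le_mul_of_nonneg_left ht.2 hKpos.le
        have h7 : b + c * t + l - b - c * t = l := by ring
        rw [h7]
        linarith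
    · intro t ht x h1 h2
      have h3 := lt_min_iff.1 h2
      obtain ⟨d1, d2, d3⟩ := hpde t (hsubO t ht) x h1 h3.1
      have g1 : HasDerivAt (fun ξ : ℝ => ξ - b - c * t) 1 x :=
        ((hasDerivAt_id x).sub_const b).sub_const (c * t)
      have g2 : HasDerivAt (fun τ : ℝ => x - b - c * τ) (-(c * 1)) t :=
        ((hasDerivAt_id t).const_mul c).const_sub (x - b)
      refine ⟨d1.sub ?_, d2.sub ?_, d3.sub ?_, ?_⟩
      · exact ((g1.const_mul β).sub (((g1.pow 2).const_mul L).div_const 2)).congr_deriv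
          (by push_cast; ring)
      · convert (g1.const_mul L).const_sub β using 1
        simp
      · exact ((g2.const_mul β).sub (((g2.pow 2).const_mul L).div_const 2)).congr_deriv
          (by push_cast; ring)
      · have := hK x t (hsubO t ht)
        have h4 := hmin' t ⟨ht.1.le, ht.2⟩
        have h5 : 0 ≤ c * L * (x - b - c * t) := by
          apply mul_nonneg (by positivity); linarith
        nlinarith
  -- contradiction at the touching point
  have ht0O : t0 ∈ Ioo 0 T := hsubO t0 ⟨ht0pos, ht0.2⟩
  have hlt0 := hlt t0 (hsubI ht0)
  obtain ⟨hu0, -⟩ := hdir t0 ht0O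
  obtain ⟨hux0, -⟩ := hneu t0 ht0O
  have hslice : ContinuousOn (fun x => u x t0) (Icc (sm t0) (sp t0)) :=
    huc.comp (f := fun x : ℝ => (x, t0)) (by fun_prop)
      (fun x hx => ⟨hsubI ht0, hx.1, hx.2⟩)
  have hslicex : ContinuousOn (fun x => ux x t0) (Icc (sm t0) (sp t0)) :=
    huxc.comp (f := fun x : ℝ => (x, t0)) (by fun_prop)
      (fun x hx => ⟨ht0O, hx.1, hx.2⟩)
  have hw : ContinuousWithinAt (fun x => ux x t0) (Ioi (sm t0)) (sm t0) := by
    refine (hslicex (sm t0) ⟨le_rfl, hlt0.le⟩).mono_of_mem_nhdsWithin ?_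
    exact mem_of_superset (Ioo_mem_nhdsGT hlt0) Ioo_subset_Icc_self
  have hev := hw.tendsto.eventually (Ioi_mem_nhds (a := β) (by rw [hux0]; exact hβα))
  obtain ⟨d, hd1, hd2⟩ := mem_nhdsGT_iff_exists_Ioo_subset.1 hev
  have hd1' : sm t0 < d := hd1
  obtain ⟨x, hx1, hx2⟩ := exists_between
    (lt_min hd1' (lt_min hlt0 (by linarith : sm t0 < sm t0 + l)))
  obtain ⟨hx3, hx4, hx5⟩ : x < d ∧ x < sp t0 ∧ x < sm t0 + l := by
    simpa [lt_min_iff] using hx2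
  obtain ⟨z, hz, hzs⟩ := exists_hasDerivAt_eq_slope (fun x => u x t0) (fun x => ux x t0) hx1
    (hslice.mono (Icc_subset_Icc_right hx4.le))
    (fun y hy => (hpde t0 ht0O y hy.1 (hy.2.trans hx4)).1)
  have hz1 : β < ux z t0 := hd2 ⟨hz.1, hz.2.trans hx3⟩
  have hfin := step2 t0 ht0 x hx1.le (le_min hx4.le (by linarith))
  have e : x - b - c * t0 = x - sm t0 := by rw [hb]; ring
  rw [e] at hfin
  simp only [hu0, sub_zero] at hzs
  rw [hzs, lt_div_iff₀ (by linarith)] at hz1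
  have : 0 ≤ L * (x - sm t0) ^ 2 / 2 := by positivity
  linarith
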